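/- Let B be a once-appearance branching program computing (an extension of) the partial function γ'_n, and let ℓ_1, …, ℓ_{3n} be the variable labels of its non-sink nodes in a topological order. Then for every i ∈ {0,…,n−1} there exist a, b ∈ [n] such that {ℓ_{3i+1}, ℓ_{3i+2}, ℓ_{3i+3}} = {x_a, y_b, z_b}; moreover the induced map b ↦ a is a permutation of [n]. -/

import Mathlib

/-- A deterministic branching program over `{0,1}` on `n` variables. Nodes are
numbered so that every edge goes to a strictly larger index (this fixes a
topological order and guarantees acyclicity). `Sum.inr b` denotes the `b`-sink. -/
structure BP (n : ℕ) where
  size : ℕ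
  label : Fin size → Fin n
  next : Fin size → Bool → Fin size ⊕ Bool
  source : Fin size ⊕ Bool
  wf : ∀ i b j, next i b = Sum.inl j → i < j

namespace BP

variable {n : ℕ}

/-- Fuel-based evaluation (the fuel `B.size` always suffices thanks to `wf`). -/
def evalAux (B : BP n) (x : Fin n → Bool) : ℕ → Fin B.size ⊕ Bool → Bool
  | _, Sum.inr b => b
  | 0, Sum.inl _ => false
  | k + 1, Sum.inl i => B.evalAux x k (B.next i (x (B.label i)))

/-- The Boolean value computed by the branching program on input `x`. -/
def eval (B : BP n) (x : Fin n → Bool) : Bool :=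
  B.evalAux x B.size B.source

/-- `B` computes the total Boolean function `f`. -/
def Computes (B : BP n) (f : (Fin n → Bool) → Bool) : Prop :=
  ∀ x, B.eval x = f x

/-- A once-appearance branching program: all node labels are distinct. -/
def IsOA (B : BP n) : Prop :=
  Function.Injective B.label

end BP

/-- The variable `x i` among the `3n` variables. -/
def xV (n : ℕ) (i : Fin n) : Fin (n + n + n) := Fin.castAdd n (Fin.castAdd n i)

/-- The variable `y i` among the `3n` variables. -/
def yV (n : ℕ) (i : Fin n) : Fin (n + n + n) := Fin.castAdd n (Fin.natAdd n i)

/-- The variable `z i` among the `3n` variables. -/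
def zV (n : ℕ) (i : Fin n) : Fin (n + n + n) := Fin.natAdd (n + n) i

/-- The partial function `γ'_n : {0,1}^{3n} → {0,1,*}` (`none` is `*`):
`⋁ᵢ (yᵢ ∧ zᵢ)` if `x = 0ⁿ`; `⋁ᵢ zᵢ` if `x = 1ⁿ`; `⋁ᵢ (xᵢ ∨ yᵢ)` if `z = 1ⁿ`;
`0` if `z = 0ⁿ`; `*` otherwise. -/
def gammaP (n : ℕ) (w : Fin (n + n + n) → Bool) : Option Bool :=
  if ∀ i, w (xV n i) = false then
    some (decide (∃ i : Fin n, w (yV n i) = true ∧ w (zV n i) = true))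
  else if ∀ i, w (xV n i) = true then
    some (decide (∃ i : Fin n, w (zV n i) = true))
  else if ∀ i, w (zV n i) = true then
    some (decide (∃ i : Fin n, w (xV n i) = true ∨ w (yV n i) = true))
  else if ∀ i, w (zV n i) = false then
    some false
  else none

/-- `ρ` is a topological order of the nodes of `B`: every edge goes forward in `ρ`. -/
def BP.IsTopo {n : ℕ} (B : BP n) (ρ : Equiv.Perm (Fin B.size)) : Prop :=
  ∀ i b j, B.next i b = Sum.inl j → ρ i < ρ j

/-- `B` computes the partial function `g` (agrees with it wherever it is defined). -/
def BP.ComputesPartial {n : ℕ} (B : BP n) (g : (Fin n → Bool) → Option Bool) : Prop :=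
  ∀ w b, g w = some b → B.eval w = b

namespace BP

variable {m : ℕ} (B : BP m)

lemma evalAux_succ_eq (w : Fin m → Bool) (k : ℕ) :
    ∀ s : Fin B.size ⊕ Bool, (∀ i, s = Sum.inl i → B.size ≤ k + i.val) →
      B.evalAux w (k + 1) s = B.evalAux w k s := by
  induction k with
  | zero =>
    rintro (i | b) h
    · have := h i rfl
      omega
    · rfl
  | succ k ih =>
    rintro (i | b) h
    · have hi := h i rfl
      rw [evalAux, evalAux]
      refine ih _ fun j hj => ?_
      have : i.val < j.val := B.wf i _ j hj
      omega
    · rfl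

lemma evalAux_inr (w : Fin m → Bool) (k : ℕ) (b : Bool) :
    B.evalAux w k (Sum.inr b) = b := by
  cases k <;> rfl

/-- The value computed on input `w` when starting from the node `i`. -/
def evalFrom (w : Fin m → Bool) (i : Fin B.size) : Bool :=
  B.evalAux w B.size (Sum.inl i)

lemma evalFrom_eq (w : Fin m → Bool) (i : Fin B.size) :
    B.evalFrom w i = Sum.elim (B.evalFrom w) id (B.next i (w (B.label i))) := by
  have h : B.evalFrom w i = B.evalAux w B.size (B.next i (w (B.label i))) := by
    rw [evalFrom, ← B.evalAux_succ_eq w B.size (Sum.inl i) (fun _ _ => by omega), evalAux]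
  rw [h]
  rcases B.next i (w (B.label i)) with j | b
  · rfl
  · simp [evalAux_inr]

/-- The computation on input `w` started at node `i` visits node `j`. -/
def Hits (w : Fin m → Bool) : Fin B.size → Fin B.size → Prop :=
  Relation.ReflTransGen fun i j => B.next i (w (B.label i)) = Sum.inl j

variable {B}

lemma Hits.le {w : Fin m → Bool} {i j : Fin B.size} (h : B.Hits w i j) : i ≤ j := by
  induction h with
  | refl => exact le_rfl
  | tail _ h ih => exact ih.trans (B.wf _ _ _ h).le

lemma Hits.evalFrom_eq {w : Fin m → Bool} {i j : Fin B.size} (h : B.Hits w i j) :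
    B.evalFrom w i = B.evalFrom w j := by
  induction h with
  | refl => rfl
  | tail _ h ih => rw [ih, BP.evalFrom_eq, h, Sum.elim_inl]

lemma Hits.congr {w w' : Fin m → Bool} {i j : Fin B.size} (h : B.Hits w i j)
    (hw : ∀ k, i ≤ k → k < j → w (B.label k) = w' (B.label k)) : B.Hits w' i j := by
  induction h with
  | refl => exact .refl
  | @tail k l hk h ih =>
    have hkl := B.wf _ _ _ h
    refine (ih fun r h1 h2 => hw r h1 (h2.trans hkl)).tail ?_
    rw [← hw k (Hits.le hk) hkl, h]

lemma evalFrom_congr {w w' : Fin m → Bool} (i : Fin B.size)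
    (hw : ∀ k, i ≤ k → w (B.label k) = w' (B.label k)) : B.evalFrom w i = B.evalFrom w' i := by
  induction i using WellFoundedGT.induction with
  | ind i ih =>
    rw [evalFrom_eq, evalFrom_eq B w', ← hw i le_rfl]
    rcases h : B.next i (w (B.label i)) with j | b
    · have hij := B.wf _ _ _ h
      exact ih j hij fun k hk => hw k (hij.le.trans hk)
    · rfl

lemma hits_of_evalFrom_ne {w w' : Fin m → Bool} {v : Fin B.size} (i : Fin B.size)
    (hw : ∀ k, k ≠ v → w (B.label k) = w' (B.label k))
    (hne : B.evalFrom w i ≠ B.evalFrom w' i) : B.Hits w i v := by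
  induction i using WellFoundedGT.induction with
  | ind i ih =>
    by_cases hi : i = v
    · subst hi
      exact .refl
    rw [evalFrom_eq, evalFrom_eq B w', ← hw i hi] at hne
    rcases h : B.next i (w (B.label i)) with j | b
    · rw [h] at hne
      exact .head h (ih j (B.wf _ _ _ h) hne)
    · simp [h] at hne

lemma Hits.exists_next {w : Fin m → Bool} {i j k : Fin B.size} (hj : B.Hits w i j)
    (hk : B.Hits w i k) (hjk : j < k) :
    ∃ q, B.next j (w (B.label j)) = Sum.inl q ∧ B.Hits w q k := by
  have hjk' : B.Hits w j k := by
    refine (Relation.ReflTransGen.total_of_right_unique ?_ hj hk).resolve_right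
      fun h => absurd (Hits.le h) (not_le.2 hjk)
    intro a b c hb hc
    exact Sum.inl_injective (hb.symm.trans hc)
  rcases Relation.ReflTransGen.cases_head hjk' with h | ⟨q, hq, h⟩
  · exact absurd h hjk.ne
  · exact ⟨q, hq, h⟩

lemma Hits.evalFrom_of_agree {w w' : Fin m → Bool} {i q : Fin B.size}
    (h : B.Hits w i q) (hlt : ∀ k, i ≤ k → k < q → w (B.label k) = w' (B.label k)) :
    B.evalFrom w' i = B.evalFrom w' q :=
  (h.congr hlt).evalFrom_eq

/-- The program with its nodes renumbered along a topological order. -/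
def reindex (B : BP m) (ρ : Equiv.Perm (Fin B.size)) (hρ : B.IsTopo ρ) : BP m where
  size := B.size
  label i := B.label (ρ.symm i)
  next i b := Sum.map ρ id (B.next (ρ.symm i) b)
  source := Sum.map ρ id B.source
  wf i b j h := by
    rcases h' : B.next (ρ.symm i) b with k | c
    · rw [h'] at h
      have := hρ _ _ _ h'
      simp only [Sum.map_inl, Sum.inl.injEq] at h
      simpa [h] using this
    · simp [h'] at h

lemma evalAux_reindex (B : BP m) (ρ : Equiv.Perm (Fin B.size)) (hρ : B.IsTopo ρ)
    (w : Fin m → Bool) (k : ℕ) :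
    ∀ s, (B.reindex ρ hρ).evalAux w k (Sum.map ρ id s) = B.evalAux w k s := by
  induction k with
  | zero => rintro (i | b) <;> rfl
  | succ k ih =>
    rintro (i | b)
    · change (B.reindex ρ hρ).evalAux w k (Sum.map ρ id
        (B.next (ρ.symm (ρ i)) (w (B.label (ρ.symm (ρ i)))))) = _
      rw [ρ.symm_apply_apply]
      exact ih _
    · rfl

lemma eval_reindex (B : BP m) (ρ : Equiv.Perm (Fin B.size)) (hρ : B.IsTopo ρ)
    (w : Fin m → Bool) : (B.reindex ρ hρ).eval w = B.eval w :=
  B.evalAux_reindex ρ hρ w B.size B.source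

end BP

section Triplets

variable {n : ℕ}

/-- The input with the given `x`-, `y`- and `z`-parts. -/
def mkInput (x y z : Fin n → Bool) : Fin (n + n + n) → Bool :=
  Fin.append (Fin.append x y) z

@[simp] lemma mkInput_xV (x y z : Fin n → Bool) (i : Fin n) : mkInput x y z (xV n i) = x i := by
  simp [mkInput, xV]

@[simp] lemma mkInput_yV (x y z : Fin n → Bool) (i : Fin n) : mkInput x y z (yV n i) = y i :=
  (Fin.append_left _ _ _).trans (Fin.append_right _ _ _)

@[simp] lemma mkInput_zV (x y z : Fin n → Bool) (i : Fin n) : mkInput x y z (zV n i) = z i := by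
  simp [mkInput, zV]

lemma forall_var {P : Fin (n + n + n) → Prop} (hx : ∀ a, P (xV n a)) (hy : ∀ b, P (yV n b))
    (hz : ∀ b, P (zV n b)) (v : Fin (n + n + n)) : P v := by
  induction v using Fin.addCases with
  | left v =>
    induction v using Fin.addCases with
    | left a => exact hx a
    | right b => exact hy b
  | right b => exact hz b

@[simp] lemma xV_inj {a b : Fin n} : xV n a = xV n b ↔ a = b := by
  simp [xV]

@[simp] lemma yV_inj {a b : Fin n} : yV n a = yV n b ↔ a = b := by
  simp [yV]

@[simp] lemma zV_inj {a b : Fin n} : zV n a = zV n b ↔ a = b := by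
  simp [zV]

@[simp] lemma xV_ne_yV (a b : Fin n) : xV n a ≠ yV n b := by
  simp [xV, yV, Fin.ext_iff]; omega

@[simp] lemma xV_ne_zV (a b : Fin n) : xV n a ≠ zV n b := by
  simp [xV, zV, Fin.ext_iff]; omega

@[simp] lemma yV_ne_zV (a b : Fin n) : yV n a ≠ zV n b := by
  simp [yV, zV, Fin.ext_iff]; omega

@[simp] lemma yV_ne_xV (a b : Fin n) : yV n a ≠ xV n b := (xV_ne_yV b a).symm

@[simp] lemma zV_ne_xV (a b : Fin n) : zV n a ≠ xV n b := (xV_ne_zV b a).symm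

@[simp] lemma zV_ne_yV (a b : Fin n) : zV n a ≠ yV n b := (yV_ne_zV b a).symm

/-- The subprogram rooted at node `i` computes `γ'` restricted to the variables `x_a`, `a ∈ J`,
and `y_b, z_b`, `b ∈ L`, except possibly for the clause `z = 0`. -/
structure BP.Spec (B : BP (n + n + n)) (i : Fin B.size) (J L : Finset (Fin n)) : Prop where
  x_zero : ∀ w, (∀ a ∈ J, w (xV n a) = false) →
    (B.evalFrom w i = true ↔ ∃ b ∈ L, w (yV n b) = true ∧ w (zV n b) = true)
  x_one : ∀ w, (∀ a ∈ J, w (xV n a) = true) →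
    (B.evalFrom w i = true ↔ ∃ b ∈ L, w (zV n b) = true)
  z_one : ∀ w, (∀ b ∈ L, w (zV n b) = true) →
    (B.evalFrom w i = true ↔
      (∃ a ∈ J, w (xV n a) = true) ∨ ∃ b ∈ L, w (yV n b) = true)

/-- The variables at positions at least `t` are the `x_a`, `a ∈ J`, and `y_b, z_b`, `b ∈ L`. -/
structure BP.Rest (B : BP (n + n + n)) (e : Fin B.size ≃ Fin (n + n + n)) (t : ℕ)
    (J L : Finset (Fin n)) : Prop where
  x_iff : ∀ a, a ∈ J ↔ t ≤ (e.symm (xV n a)).val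
  y_iff : ∀ b, b ∈ L ↔ t ≤ (e.symm (yV n b)).val
  z_iff : ∀ b, b ∈ L ↔ t ≤ (e.symm (zV n b)).val

variable {B : BP (n + n + n)} {e : Fin B.size ≃ Fin (n + n + n)}

lemma BP.hits_pos (he : ∀ k, e k = B.label k) {w w' : Fin (n + n + n) → Bool}
    {i : Fin B.size} {v : Fin (n + n + n)} (hw : ∀ u, u ≠ v → w u = w' u)
    (h0 : ¬ B.evalFrom w i = true) (h1 : B.evalFrom w' i = true) : B.Hits w i (e.symm v) := by
  refine BP.hits_of_evalFrom_ne (w' := w') i (fun k hk => hw _ ?_) (fun h => h0 (h.trans h1))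
  rintro rfl
  exact hk (by simp [← he])

/-- Two computations that reach the same node agree afterwards. -/
lemma BP.Hits.merge (he : ∀ k, e k = B.label k) {w₁ w₂ u₁ u₂ : Fin (n + n + n) → Bool}
    {i q : Fin B.size} (h₁ : B.Hits w₁ i q) (h₂ : B.Hits w₂ i q)
    (h₁' : ∀ v, i ≤ e.symm v → e.symm v < q → w₁ v = u₁ v)
    (h₂' : ∀ v, i ≤ e.symm v → e.symm v < q → w₂ v = u₂ v)
    (hu : ∀ v, q ≤ e.symm v → u₁ v = u₂ v) : B.evalFrom u₁ i = B.evalFrom u₂ i := by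
  rw [h₁.evalFrom_of_agree (w' := u₁) fun k hk hk' => h₁' _ (by simpa [← he]) (by simpa [← he]),
    h₂.evalFrom_of_agree (w' := u₂) fun k hk hk' => h₂' _ (by simpa [← he]) (by simpa [← he])]
  exact BP.evalFrom_congr q fun k hk => hu _ (by simpa [← he])

/-- `y_b` for `true` and `z_b` for `false`. -/
def yzV (n : ℕ) (s : Bool) (b : Fin n) : Fin (n + n + n) := bif s then yV n b else zV n b

lemma yzV_inj {s s' : Bool} {b b' : Fin n} (h : yzV n s b = yzV n s' b') : s = s' ∧ b = b' := by
  cases s <;> cases s' <;> simp [yzV] at h ⊢ <;> exact h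

lemma mkInput_yzV (x : Fin n → Bool) (g : Bool → Fin n → Bool) (s : Bool) (b : Fin n) :
    mkInput x (g true) (g false) (yzV n s b) = g s b := by
  cases s <;> simp [yzV]

lemma forall_var_yz {P : Fin (n + n + n) → Prop} (hx : ∀ a, P (xV n a))
    (hyz : ∀ s b, P (yzV n s b)) (v : Fin (n + n + n)) : P v :=
  forall_var hx (hyz true) (hyz false) v

/-- Both variables `y_b, z_b` of some pair precede all other `y`- and `z`-variables. -/
lemma BP.exists_first_pair (he : ∀ k, e k = B.label k) {i : Fin B.size} {J L : Finset (Fin n)}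
    (hL : L.Nonempty) (hR : B.Rest e i J L) (hS : B.Spec i J L) :
    ∃ b ∈ L, ∀ b' ∈ L, b' ≠ b → ∀ s s', e.symm (yzV n s b) < e.symm (yzV n s' b') := by
  have hmem : ∀ s b, i ≤ e.symm (yzV n s b) → b ∈ L := by
    intro s b h
    cases s
    · exact (hR.z_iff b).2 h
    · exact (hR.y_iff b).2 h
  obtain ⟨⟨s, b⟩, hb, hmin⟩ := Finset.exists_min_image
    ((Finset.univ : Finset Bool) ×ˢ L) (fun p => e.symm (yzV n p.1 p.2)) (by simpa using hL)
  simp only [Finset.mem_product, Finset.mem_univ, true_and, Prod.forall] at hb hmin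
  refine ⟨b, hb, ?_⟩
  by_cases hL' : (L.erase b).Nonempty
  swap
  · intro b' hb' hne
    exact absurd ⟨b', Finset.mem_erase.2 ⟨hne, hb'⟩⟩ hL'
  obtain ⟨⟨s', b'⟩, hb', hmin'⟩ := Finset.exists_min_image
    ((Finset.univ : Finset Bool) ×ˢ L.erase b) (fun p => e.symm (yzV n p.1 p.2))
    (by simpa using hL')
  simp only [Finset.mem_product, Finset.mem_univ, true_and, Prod.forall, Finset.mem_erase]
    at hb' hmin'
  suffices hlt : e.symm (yzV n (!s) b) < e.symm (yzV n s' b') by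
    intro c hc hcb σ σ'
    by_cases hσ : σ = s
    · subst hσ
      refine lt_of_le_of_ne (hmin _ _ hc) fun h => hcb ?_
      exact (yzV_inj (e.symm.injective h)).2.symm
    · have : σ = !s := by cases σ <;> cases s <;> simp_all
      subst this
      exact hlt.trans_le (hmin' _ _ ⟨hcb, hc⟩)
  by_contra! hge
  have hgt : e.symm (yzV n s' b') < e.symm (yzV n (!s) b) :=
    lt_of_le_of_ne hge fun h => hb'.1 (yzV_inj (e.symm.injective h)).2
  set g : Bool → Bool → Bool → Fin n → Bool := fun c d σ β =>
    decide ((σ = s ∧ β = b ∧ c = true) ∨ (σ = (!s') ∧ β = b') ∨ (σ = s' ∧ β = b' ∧ d = true))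
    with hg
  set f : Bool → Bool → Fin n → Bool := fun c σ β => decide (β = b ∧ (σ = s → c = true)) with hf
  have hhit : ∀ c, B.Hits (mkInput (fun _ => false) (g c false true) (g c false false)) i
      (e.symm (yzV n s' b')) := by
    intro c
    refine BP.hits_pos he (w' := mkInput (fun _ => false) (g c true true) (g c true false))
      ?_ ?_ ?_
    · refine forall_var_yz (by simp) fun σ β h => ?_
      rw [mkInput_yzV, mkInput_yzV]
      have : ¬ (σ = s' ∧ β = b') := by
        rintro ⟨rfl, rfl⟩
        exact h rfl
      simp only [hg]
      grind
    · rw [hS.x_zero _ (by simp)]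
      simp only [hg, mkInput_yV, mkInput_zV]
      grind
    · rw [hS.x_zero _ (by simp)]
      refine ⟨b', hb'.2, ?_⟩
      simp only [hg, mkInput_yV, mkInput_zV]
      grind
  have hagree : ∀ c v, i ≤ e.symm v → e.symm v < e.symm (yzV n s' b') →
      mkInput (fun _ => false) (g c false true) (g c false false) v =
        mkInput (fun _ => false) (f c true) (f c false) v := by
    intro c
    refine forall_var_yz (by simp) fun σ β hi hlt => ?_
    have hβ : β = b := by
      by_contra hne
      exact absurd (hmin' σ β ⟨hne, hmem _ _ hi⟩) (not_le.2 hlt)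
    subst hβ
    have hσ : σ = s := by
      by_contra hne
      have : σ = !s := by cases σ <;> cases s <;> simp_all
      subst this
      exact absurd (hlt.trans hgt) (lt_irrefl _)
    subst hσ
    rw [mkInput_yzV, mkInput_yzV]
    have := hb'.1
    simp only [hg, hf]
    grind
  have hmerge := (hhit true).merge he (hhit false) (hagree true) (hagree false) (by
    refine forall_var_yz (by simp) fun σ β hle => ?_
    rw [mkInput_yzV, mkInput_yzV]
    have : ¬ (σ = s ∧ β = b) := by
      rintro ⟨rfl, rfl⟩
      refine absurd (hmin s' b' hb'.2) (not_le.2 (lt_of_le_of_ne hle fun h => ?_))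
      exact hb'.1 (yzV_inj (e.symm.injective h)).2
    simp only [hf]
    grind)
  rw [Bool.eq_iff_iff, hS.x_zero _ (by simp), hS.x_zero _ (by simp)] at hmerge
  obtain ⟨β, -, h1, h2⟩ := hmerge.1 ⟨b, hb, by simp [hf]⟩
  simp only [hf, mkInput_yV, mkInput_zV] at h1 h2
  grind

lemma BP.Spec.x_nonempty {i : Fin B.size} {J L : Finset (Fin n)} (hS : B.Spec i J L)
    (hL : L.Nonempty) : J.Nonempty := by
  by_contra hJ
  rw [Finset.not_nonempty_iff_eq_empty] at hJ
  subst hJ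
  obtain ⟨b, hb⟩ := hL
  have h0 := hS.x_zero (mkInput (fun _ => false) (fun _ => false) (fun _ => true)) (by simp)
  have h1 := hS.x_one (mkInput (fun _ => false) (fun _ => false) (fun _ => true)) (by simp)
  rw [h0] at h1
  obtain ⟨c, -, hc, -⟩ := h1.2 ⟨b, hb, by simp⟩
  simp at hc

lemma BP.Spec.hits_of_z_one (he : ∀ k, e k = B.label k) {i : Fin B.size} {J L : Finset (Fin n)}
    (hS : B.Spec i J L) {v : Fin (n + n + n)}
    (hv : (∃ a ∈ J, v = xV n a) ∨ ∃ b ∈ L, v = yV n b) :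
    B.Hits (mkInput (fun _ => false) (fun _ => false) (fun _ => true)) i (e.symm v) := by
  refine BP.hits_pos he (w' := Function.update
    (mkInput (fun _ => false) (fun _ => false) (fun _ => true)) v true)
    (fun u hu => by simp [hu]) ?_ ?_
  · rw [hS.z_one _ (by simp)]
    simp
  · rcases hv with ⟨a, ha, rfl⟩ | ⟨b, hb, rfl⟩
    · rw [hS.z_one _ (by simp)]
      exact Or.inl ⟨a, ha, by simp⟩
    · rw [hS.z_one _ (by simp)]
      exact Or.inr ⟨b, hb, by simp⟩

lemma BP.Spec.hits_of_x_one (he : ∀ k, e k = B.label k) {i : Fin B.size} {J L : Finset (Fin n)}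
    (hS : B.Spec i J L) {b : Fin n} (hb : b ∈ L) :
    B.Hits (mkInput (fun _ => true) (fun _ => false) (fun _ => false)) i
      (e.symm (zV n b)) := by
  refine BP.hits_pos he (w' := Function.update
    (mkInput (fun _ => true) (fun _ => false) (fun _ => false)) (zV n b) true)
    (fun u hu => by simp [hu]) ?_ ?_
  · rw [hS.x_one _ (by simp)]
    simp
  · rw [hS.x_one _ (by simp)]
    exact ⟨b, hb, by simp⟩

/-- Reading `z_b = 0` for the first pair `b` leads to a node where `γ'` on fewer variables is
computed. -/
lemma BP.exists_smaller_spec (he : ∀ k, e k = B.label k) {i : Fin B.size}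
    {J L : Finset (Fin n)} (hR : B.Rest e i J L) (hS : B.Spec i J L) {b : Fin n} (hb : b ∈ L)
    (hfirst : ∀ b' ∈ L, b' ≠ b → ∀ s s', e.symm (yzV n s b) < e.symm (yzV n s' b'))
    (hL' : (L.erase b).Nonempty) :
    ∃ (q : Fin B.size) (J' : Finset (Fin n)), J' ⊂ J ∧ B.Rest e q J' (L.erase b) ∧
      B.Spec q J' (L.erase b) := by
  have hyy : ∀ b' ∈ L, b' ≠ b → e.symm (yV n b) < e.symm (yV n b') :=
    fun b' h h' => hfirst b' h h' true true
  have hyz : ∀ b' ∈ L, b' ≠ b → e.symm (yV n b) < e.symm (zV n b') :=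
    fun b' h h' => hfirst b' h h' true false
  have hzy : ∀ b' ∈ L, b' ≠ b → e.symm (zV n b) < e.symm (yV n b') :=
    fun b' h h' => hfirst b' h h' false true
  have hzz : ∀ b' ∈ L, b' ≠ b → e.symm (zV n b) < e.symm (zV n b') :=
    fun b' h h' => hfirst b' h h' false false
  clear hfirst
  have hiz : i ≤ e.symm (zV n b) := (hR.z_iff b).1 hb
  set wx := mkInput (n := n) (fun _ => true) (fun _ => false) (fun _ => false) with hwx
  obtain ⟨b₁, hb₁⟩ := hL'
  rw [Finset.mem_erase] at hb₁
  obtain ⟨q, hq, -⟩ := (hS.hits_of_x_one he hb).exists_next (hS.hits_of_x_one he hb₁.2)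
    (hzz b₁ hb₁.2 hb₁.1)
  rw [← he, e.apply_symm_apply, mkInput_zV] at hq
  have hzq : e.symm (zV n b) < q := B.wf _ _ _ hq
  have through : ∀ {w}, B.Hits w i (e.symm (zV n b)) → w (zV n b) = false → B.Hits w i q := by
    intro w h hw
    refine h.tail ?_
    rw [← he, e.apply_symm_apply, hw, hq]
  have through_le : ∀ {w k}, B.Hits w i (e.symm (zV n b)) → w (zV n b) = false →
      B.Hits w i k → e.symm (zV n b) < k → q ≤ k := by
    intro w k h hw hk hlt
    obtain ⟨q', hq', hk'⟩ := h.exists_next hk hlt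
    rw [← he, e.apply_symm_apply, hw, hq, Sum.inl.injEq] at hq'
    subst hq'
    exact hk'.le
  have hwxq : B.Hits wx i q := through (hS.hits_of_x_one he hb) (by simp [hwx])
  have hqz : ∀ β ∈ L, β ≠ b → q ≤ e.symm (zV n β) := fun β hβ hne =>
    through_le (hS.hits_of_x_one he hb) (by simp) (hS.hits_of_x_one he hβ) (hzz β hβ hne)
  have hqy : ∀ β ∈ L, β ≠ b → q ≤ e.symm (yV n β) := by
    intro β hβ hne
    set w := mkInput (fun _ => false) (fun c => decide (c ≠ β)) (fun c => decide (c = β)) with hw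
    have h0 : ¬ B.evalFrom w i = true := by
      rw [hS.x_zero _ (by simp [hw])]
      simp [hw]
    have h1 : B.Hits w i (e.symm (yV n β)) := by
      refine BP.hits_pos he (w' := Function.update w (yV n β) true)
        (fun u hu => by simp [hu]) h0 ?_
      rw [hS.x_zero _ (by simp [hw])]
      exact ⟨β, hβ, by simp [hw]⟩
    have h2 : B.Hits w i (e.symm (zV n b)) := by
      refine BP.hits_pos he (w' := Function.update w (zV n b) true)
        (fun u hu => by simp [hu]) h0 ?_
      rw [hS.x_zero _ (by simp [hw])]
      exact ⟨b, hb, by simp [hw, hne.symm]⟩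
    exact through_le h2 (by simp [hw, hne.symm]) h1 (hzy β hβ hne)
  have hiq : i ≤ q := hiz.trans hzq.le
  have hyq : e.symm (yV n b) < q := by
    by_contra! hge
    have hq1 : B.Hits (mkInput (fun _ => false) (fun _ => false) (fun _ => true)) i q := by
      have hlab : ∀ v, e.symm v = q → (∃ a ∈ J, v = xV n a) ∨ ∃ b ∈ L, v = yV n b := by
        refine forall_var (fun a h => Or.inl ⟨a, (hR.x_iff a).2 (h ▸ hiq), rfl⟩)
          (fun b h => Or.inr ⟨b, (hR.y_iff b).2 (h ▸ hiq), rfl⟩) fun β h => ?_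
        by_cases hβ : β = b
        · subst hβ
          exact absurd h hzq.ne
        · have := hyz β ((hR.z_iff β).2 (h ▸ hiq)) hβ
          rw [h] at this
          exact absurd this (not_lt.2 hge)
      have := hS.hits_of_z_one he (hlab (e q) (by simp))
      rwa [e.symm_apply_apply] at this
    have hq0 : B.Hits (mkInput (fun _ => false) (fun _ => true) (fun _ => false)) i q := by
      refine through (BP.hits_pos he (w' := Function.update
        (mkInput (fun _ => false) (fun _ => true) (fun _ => false)) (zV n b) true)
        (fun u hu => by simp [hu]) ?_ ?_) (by simp)
      · rw [hS.x_zero _ (by simp)]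
        simp
      · rw [hS.x_zero _ (by simp)]
        exact ⟨b, hb, by simp⟩
    have hy_not : ∀ β, i ≤ e.symm (yV n β) → ¬ e.symm (yV n β) < q := by
      intro β h1 h2
      by_cases hβ : β = b
      · subst hβ
        exact absurd h2 (not_lt.2 hge)
      · exact absurd (hyy β ((hR.y_iff β).2 h1) hβ) (not_lt.2 (h2.le.trans hge))
    have hz_eq : ∀ β, i ≤ e.symm (zV n β) → e.symm (zV n β) < q → β = b := by
      intro β h1 h2
      by_contra hβ
      exact absurd (hyz β ((hR.z_iff β).2 h1) hβ) (not_lt.2 (h2.le.trans hge))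
    have hmerge := hq1.merge he hq0
      (u₁ := mkInput (fun _ => false) (fun c => decide (c = b)) (fun c => decide (c = b)))
      (u₂ := mkInput (fun _ => false) (fun c => decide (c = b)) (fun _ => false))
      (forall_var (by simp) (fun β h1 h2 => absurd h2 (hy_not β h1))
        (fun β h1 h2 => by simp [hz_eq β h1 h2]))
      (forall_var (by simp) (fun β h1 h2 => absurd h2 (hy_not β h1)) (by simp))
      (forall_var (by simp) (by simp) (fun β h => by
        have : β ≠ b := by
          rintro rfl
          exact absurd hzq (not_lt.2 h)
        simp [this]))
    rw [Bool.eq_iff_iff, hS.x_zero _ (by simp), hS.x_zero _ (by simp)] at hmerge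
    simpa using hmerge.1 ⟨b, hb, by simp⟩
  have hprefix : ∀ {w u : Fin (n + n + n) → Bool},
      (∀ a ∈ J, e.symm (xV n a) < q → w (xV n a) = u (xV n a)) →
      w (yV n b) = u (yV n b) → w (zV n b) = u (zV n b) →
      ∀ v, i ≤ e.symm v → e.symm v < q → w v = u v := by
    intro w u hx hy hz
    refine forall_var (fun a h h' => hx a ((hR.x_iff a).2 h) h') (fun β h h' => ?_)
      (fun β h h' => ?_)
    · by_cases hβ : β = b
      · rw [hβ, hy]
      · exact absurd (hqy β ((hR.y_iff β).2 h) hβ) (not_le.2 h')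
    · by_cases hβ : β = b
      · rw [hβ, hz]
      · exact absurd (hqz β ((hR.z_iff β).2 h) hβ) (not_le.2 h')
  have hwzq : B.Hits (mkInput (fun _ => false) (fun _ => false) (fun _ => true)) i q := by
    have key : ∀ v, e.symm v = q →
        B.Hits (mkInput (fun _ => false) (fun _ => false) (fun _ => true)) i q := by
      refine forall_var (fun a h => ?_) (fun β h => ?_) (fun β h => ?_)
      · exact h ▸ hS.hits_of_z_one he (Or.inl ⟨a, (hR.x_iff a).2 (h ▸ hiq), rfl⟩)
      · exact h ▸ hS.hits_of_z_one he (Or.inr ⟨β, (hR.y_iff β).2 (h ▸ hiq), rfl⟩)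
      · have hβL : β ∈ L := (hR.z_iff β).2 (h ▸ hiq)
        have hβ : β ≠ b := by
          rintro rfl
          exact absurd h hzq.ne
        set w := mkInput (fun _ => false) (fun c => decide (c = β)) (fun c => decide (c = b))
          with hw
        have hwq : B.Hits w i q := by
          rw [← h]
          refine BP.hits_pos he (w' := Function.update w (zV n β) true)
            (fun u hu => by simp [hu]) ?_ ?_
          · rw [hS.x_zero _ (by simp [hw])]
            simp only [hw, mkInput_yV, mkInput_zV]
            grind
          · rw [hS.x_zero _ (by simp [hw])]
            exact ⟨β, hβL, by simp [hw]⟩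
        refine hwq.congr fun k hk hk' => ?_
        have := hprefix (w := w)
          (u := mkInput (fun _ => false) (fun _ => false) (fun _ => true))
          (by simp [hw]) (by simp [hw, hβ.symm]) (by simp [hw]) (e k) (by simpa) (by simpa)
        rwa [he] at this
    exact key (e q) (by simp)
  set splice : (Fin (n + n + n) → Bool) → (Fin (n + n + n) → Bool) → Fin (n + n + n) → Bool :=
    fun p w v => if e.symm v < q then p v else w v with hsplice
  have hsp : ∀ {p} w, B.Hits p i q → B.evalFrom w q = B.evalFrom (splice p w) i := by
    intro p w h
    rw [h.evalFrom_of_agree (w' := splice p w) fun k _ hk => by simp [hsplice, ← he, hk]]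
    exact BP.evalFrom_congr q fun k hk => by simp [hsplice, ← he, not_lt.2 hk]
  have hys : ∀ β ∈ L, β ≠ b → ∀ p w, splice p w (yV n β) = w (yV n β) := fun β h h' p w => by
    simp [hsplice, not_lt.2 (hqy β h h')]
  have hzs : ∀ β ∈ L, β ≠ b → ∀ p w, splice p w (zV n β) = w (zV n β) := fun β h h' p w => by
    simp [hsplice, not_lt.2 (hqz β h h')]
  have hyb : ∀ p w, splice p w (yV n b) = p (yV n b) := fun p w => by simp [hsplice, hyq]
  have hzb : ∀ p w, splice p w (zV n b) = p (zV n b) := fun p w => by simp [hsplice, hzq]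
  refine ⟨q, J.filter fun a => q ≤ e.symm (xV n a), ?_, ?_, ?_⟩
  · refine (Finset.filter_subset _ _).ssubset_of_ne fun hJ => ?_
    rw [Finset.filter_eq_self] at hJ
    have hmerge := hwxq.merge he hwzq
      (u₁ := wx) (u₂ := mkInput (fun _ => true) (fun _ => false) (fun c => decide (c = b)))
      (fun _ _ _ => rfl)
      (hprefix (fun a ha h => absurd (hJ a ha) (not_le.2 h)) (by simp) (by simp))
      (forall_var (by simp [hwx]) (by simp [hwx]) (fun β h => by
        have : β ≠ b := by
          rintro rfl
          exact absurd hzq (not_lt.2 h)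
        simp [hwx, this]))
    rw [Bool.eq_iff_iff, hS.x_one _ (by simp [hwx]), hS.x_one _ (by simp)] at hmerge
    simpa [hwx] using hmerge.2 ⟨b, hb, by simp⟩
  · refine ⟨fun a => ?_, fun β => ?_, fun β => ?_⟩
    · rw [Finset.mem_filter, hR.x_iff]
      exact ⟨fun h => h.2, fun h => ⟨(Fin.le_def.1 hiq).trans h, h⟩⟩
    · rw [Finset.mem_erase]
      refine ⟨fun h => hqy β h.2 h.1, fun h => ⟨?_, (hR.y_iff β).2 ((Fin.le_def.1 hiq).trans h)⟩⟩
      rintro rfl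
      exact absurd hyq (not_lt.2 h)
    · rw [Finset.mem_erase]
      refine ⟨fun h => hqz β h.2 h.1, fun h => ⟨?_, (hR.z_iff β).2 ((Fin.le_def.1 hiq).trans h)⟩⟩
      rintro rfl
      exact absurd hzq (not_lt.2 h)
  · refine ⟨fun w hw => ?_, fun w hw => ?_, fun w hw => ?_⟩
    · rw [hsp w hwzq, hS.x_zero]
      · constructor
        · rintro ⟨β, hβ, h1, h2⟩
          have hne : β ≠ b := by
            rintro rfl
            simp [hyb] at h1
          rw [hys β hβ hne] at h1
          rw [hzs β hβ hne] at h2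
          exact ⟨β, Finset.mem_erase.2 ⟨hne, hβ⟩, h1, h2⟩
        · rintro ⟨β, hβ, h⟩
          rw [Finset.mem_erase] at hβ
          exact ⟨β, hβ.2, by rwa [hys β hβ.2 hβ.1, hzs β hβ.2 hβ.1]⟩
      · intro a ha
        by_cases h : e.symm (xV n a) < q
        · simp [hsplice, h]
        · simpa [hsplice, h] using hw a (Finset.mem_filter.2 ⟨ha, not_lt.1 h⟩)
    · rw [hsp w hwxq, hS.x_one]
      · constructor
        · rintro ⟨β, hβ, h2⟩
          have hne : β ≠ b := by
            rintro rfl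
            simp [hzb, hwx] at h2
          rw [hzs β hβ hne] at h2
          exact ⟨β, Finset.mem_erase.2 ⟨hne, hβ⟩, h2⟩
        · rintro ⟨β, hβ, h⟩
          rw [Finset.mem_erase] at hβ
          exact ⟨β, hβ.2, by rwa [hzs β hβ.2 hβ.1]⟩
      · intro a ha
        by_cases h : e.symm (xV n a) < q
        · simp [hsplice, h, hwx]
        · simpa [hsplice, h] using hw a (Finset.mem_filter.2 ⟨ha, not_lt.1 h⟩)
    · rw [hsp w hwzq, hS.z_one]
      · refine or_congr ⟨?_, ?_⟩ ⟨?_, ?_⟩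
        · rintro ⟨a, ha, h1⟩
          by_cases h : e.symm (xV n a) < q
          · simp [hsplice, h] at h1
          · exact ⟨a, Finset.mem_filter.2 ⟨ha, not_lt.1 h⟩, by simpa [hsplice, h] using h1⟩
        · rintro ⟨a, ha, h1⟩
          rw [Finset.mem_filter] at ha
          exact ⟨a, ha.1, by simpa [hsplice, not_lt.2 ha.2] using h1⟩
        · rintro ⟨β, hβ, h1⟩
          have hne : β ≠ b := by
            rintro rfl
            simp [hyb] at h1
          rw [hys β hβ hne] at h1
          exact ⟨β, Finset.mem_erase.2 ⟨hne, hβ⟩, h1⟩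
        · rintro ⟨β, hβ, h⟩
          rw [Finset.mem_erase] at hβ
          exact ⟨β, hβ.2, by rwa [hys β hβ.2 hβ.1]⟩
      · intro β hβ
        by_cases hne : β = b
        · rw [hne, hzb, mkInput_zV]
        · rw [hzs β hβ hne]
          exact hw β (Finset.mem_erase.2 ⟨hne, hβ⟩)

lemma BP.Rest.size_eq {t : ℕ} {J L : Finset (Fin n)} (hR : B.Rest e t J L) (ht : t ≤ B.size) :
    B.size = t + J.card + 2 * L.card := by
  have h1 : ∑ k : Fin B.size, (if t ≤ k.val then 1 else 0) = B.size - t := by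
    rw [Fin.sum_univ_eq_sum_range (fun k => if t ≤ k then 1 else 0), ← Finset.sum_filter,
      ← Finset.card_eq_sum_ones, ← Nat.card_Ico]
    congr 1
    ext k
    simp [and_comm]
  have hx : ∑ a, (if t ≤ (e.symm (xV n a)).val then 1 else 0) = J.card := by
    simp [← hR.x_iff]
  have hy : ∑ b, (if t ≤ (e.symm (yV n b)).val then 1 else 0) = L.card := by
    simp [← hR.y_iff]
  have hz : ∑ b, (if t ≤ (e.symm (zV n b)).val then 1 else 0) = L.card := by
    simp [← hR.z_iff]
  rw [← e.symm.sum_comp, Fin.sum_univ_add, Fin.sum_univ_add] at h1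
  have h2 : J.card + L.card + L.card = B.size - t := by
    rw [← h1]
    exact congrArg₂ (· + ·) (congrArg₂ (· + ·) hx.symm hy.symm) hz.symm
  omega

/-- The `y`-`z` pairs can be matched with distinct `x`-variables, and if no `x`-variable is left
over, the remaining positions split into consecutive triplets. -/
lemma BP.triplets_of_spec (he : ∀ k, e k = B.label k) (k : ℕ) :
    ∀ (t : ℕ) (J L : Finset (Fin n)), L.card = k → t ≤ B.size → B.Rest e t J L →
      (L.Nonempty → ∃ i : Fin B.size, i.val = t ∧ B.Spec i J L) →
      k ≤ J.card ∧ (J.card = k → ∀ j < k, ∃ a b, ∀ v,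
        (t + 3 * j ≤ (e.symm v).val ∧ (e.symm v).val < t + 3 * j + 3) ↔
          v = xV n a ∨ v = yV n b ∨ v = zV n b) := by
  induction k with
  | zero => simp
  | succ k ih =>
    intro t J L hcard ht hR hS
    have hL : L.Nonempty := Finset.card_pos.1 (by omega)
    obtain ⟨i, rfl, hSpec⟩ := hS hL
    clear hS
    obtain ⟨b, hb, hfirst⟩ := BP.exists_first_pair he hL hR hSpec
    obtain ⟨t', J', hJ', ht', hR', hS'⟩ : ∃ (t' : ℕ) (J' : Finset (Fin n)), J' ⊂ J ∧
        t' ≤ B.size ∧ B.Rest e t' J' (L.erase b) ∧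
        ((L.erase b).Nonempty → ∃ i : Fin B.size, i.val = t' ∧ B.Spec i J' (L.erase b)) := by
      by_cases hL' : (L.erase b).Nonempty
      · obtain ⟨q, J', h1, h2, h3⟩ := BP.exists_smaller_spec he hR hSpec hb hfirst hL'
        exact ⟨q, J', h1, q.isLt.le, h2, fun _ => ⟨q, rfl, h3⟩⟩
      · refine ⟨B.size, ∅, Finset.empty_ssubset.2 (hSpec.x_nonempty hL), le_rfl, ?_,
          fun h => absurd h hL'⟩
        rw [Finset.not_nonempty_iff_eq_empty.1 hL']
        constructor <;> simp
    have hcard' : (L.erase b).card = k := by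
      rw [Finset.card_erase_of_mem hb, hcard, Nat.add_sub_cancel]
    obtain ⟨hle, htrip⟩ := ih t' J' (L.erase b) hcard' ht' hR' hS'
    have hlt := Finset.card_lt_card hJ'
    refine ⟨by omega, fun hJ => ?_⟩
    have hJk : J'.card = k := by omega
    have hs := hR.size_eq ht
    have hs' := hR'.size_eq ht'
    obtain rfl : t' = i.val + 3 := by omega
    rintro (_ | j) hj
    · obtain ⟨a, ha⟩ : ∃ a, J \ J' = {a} := by
        rw [← Finset.card_eq_one, Finset.card_sdiff_of_subset hJ'.subset]
        omega
      refine ⟨a, b, forall_var (fun c => ?_) (fun c => ?_) (fun c => ?_)⟩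
      · have h := Finset.ext_iff.1 ha c
        rw [Finset.mem_sdiff, hR.x_iff, hR'.x_iff, Finset.mem_singleton] at h
        simpa using h
      · have h := hR'.y_iff c
        rw [Finset.mem_erase, hR.y_iff] at h
        have hb' := (hR.y_iff b).1 hb
        by_cases hc : c = b
        · subst hc
          simp at h ⊢
          omega
        · simp [hc] at h ⊢
          omega
      · have h := hR'.z_iff c
        rw [Finset.mem_erase, hR.z_iff] at h
        have hb' := (hR.z_iff b).1 hb
        by_cases hc : c = b
        · subst hc
          simp at h ⊢
          omega
        · simp [hc] at h ⊢
          omega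
    · obtain ⟨a, b', h⟩ := htrip hJk j (by omega)
      refine ⟨a, b', fun v => ?_⟩
      rw [← h v]
      omega

lemma BP.ComputesPartial.x_zero (hcomp : B.ComputesPartial (gammaP n))
    {w : Fin (n + n + n) → Bool} (hw : ∀ a, w (xV n a) = false) :
    B.eval w = true ↔ ∃ b, w (yV n b) = true ∧ w (zV n b) = true := by
  rw [hcomp w _ (if_pos hw), decide_eq_true_iff]

lemma BP.ComputesPartial.x_one (hcomp : B.ComputesPartial (gammaP n))
    {w : Fin (n + n + n) → Bool} (hw : ∀ a, w (xV n a) = true) :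
    B.eval w = true ↔ ∃ b, w (zV n b) = true := by
  by_cases h : ∀ a, w (xV n a) = false
  · rw [hcomp.x_zero h]
    have hn : ∀ b : Fin n, False := fun b => by simpa [hw b] using h b
    exact ⟨fun ⟨b, _⟩ => (hn b).elim, fun ⟨b, _⟩ => (hn b).elim⟩
  · rw [hcomp w _ ((if_neg h).trans (if_pos hw)), decide_eq_true_iff]

lemma BP.ComputesPartial.z_one (hcomp : B.ComputesPartial (gammaP n))
    {w : Fin (n + n + n) → Bool} (hw : ∀ b, w (zV n b) = true) :
    B.eval w = true ↔ (∃ a, w (xV n a) = true) ∨ ∃ b, w (yV n b) = true := by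
  by_cases h : ∀ a, w (xV n a) = false
  · simp [hcomp.x_zero h, h, hw]
  · have hx : ∃ a, w (xV n a) = true := by simpa using h
    by_cases h' : ∀ a, w (xV n a) = true
    · rw [hcomp.x_one h']
      obtain ⟨a, ha⟩ := hx
      exact ⟨fun _ => Or.inl ⟨a, ha⟩, fun _ => ⟨a, hw a⟩⟩
    · rw [hcomp w _ ((if_neg h).trans ((if_neg h').trans (if_pos hw))), decide_eq_true_iff,
        exists_or]

lemma BP.exists_label_ne {m : ℕ} {B : BP m} {w w' : Fin m → Bool} (h : B.eval w ≠ B.eval w') :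
    ∃ k, w (B.label k) ≠ w' (B.label k) := by
  by_contra! hw
  apply h
  unfold BP.eval
  rcases B.source with i | b
  · exact BP.evalFrom_congr i fun k _ => hw k
  · simp [BP.evalAux_inr]

lemma BP.ComputesPartial.label_surjective (hcomp : B.ComputesPartial (gammaP n)) :
    Function.Surjective B.label := by
  have key : ∀ {v} (w : Fin (n + n + n) → Bool), ¬ B.eval w = true →
      B.eval (Function.update w v true) = true → ∃ k, B.label k = v := by
    intro v w h0 h1
    obtain ⟨k, hk⟩ := BP.exists_label_ne fun h => h0 (h.trans h1)
    refine ⟨k, ?_⟩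
    by_contra hne
    simp [hne] at hk
  refine forall_var (fun a => ?_) (fun b => ?_) (fun b => ?_)
  · refine key (mkInput (fun _ => false) (fun _ => false) (fun _ => true)) ?_ ?_
    · rw [hcomp.z_one (by simp)]
      simp
    · rw [hcomp.z_one (by simp)]
      exact Or.inl ⟨a, by simp⟩
  · refine key (mkInput (fun _ => false) (fun _ => false) (fun _ => true)) ?_ ?_
    · rw [hcomp.z_one (by simp)]
      simp
    · rw [hcomp.z_one (by simp)]
      exact Or.inr ⟨b, by simp⟩
  · refine key (mkInput (fun _ => true) (fun _ => false) (fun _ => false)) ?_ ?_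
    · rw [hcomp.x_one (by simp)]
      simp
    · rw [hcomp.x_one (by simp)]
      exact ⟨b, by simp⟩

lemma BP.ComputesPartial.exists_spec (hn : 0 < n) (hcomp : B.ComputesPartial (gammaP n)) :
    ∃ i : Fin B.size, B.Spec i Finset.univ Finset.univ := by
  rcases hs : B.source with i | c
  · have heval : ∀ w, B.eval w = B.evalFrom w i := fun w => by rw [BP.eval, hs, BP.evalFrom]
    refine ⟨i, fun w hw => ?_, fun w hw => ?_, fun w hw => ?_⟩
    · simpa [heval] using hcomp.x_zero (w := w) (by simpa using hw)
    · simpa [heval] using hcomp.x_one (w := w) (by simpa using hw)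
    · simpa [heval] using hcomp.z_one (w := w) (by simpa using hw)
  · exfalso
    have heval : ∀ w, B.eval w = c := fun w => by rw [BP.eval, hs, BP.evalAux_inr]
    have h0 := hcomp.x_one
      (w := mkInput (fun _ => true) (fun _ => false) (fun _ => false)) (by simp)
    have h1 := hcomp.x_one
      (w := mkInput (fun _ => true) (fun _ => false) (fun _ => true)) (by simp)
    rw [heval] at h0 h1
    obtain ⟨b, hb⟩ := h0.1 (h1.2 ⟨⟨0, hn⟩, by simp⟩)
    simp at hb

lemma BP.ComputesPartial.exists_triplets (he : ∀ k, e k = B.label k)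
    (hcomp : B.ComputesPartial (gammaP n)) :
    ∀ j < n, ∃ a b, ∀ v, (3 * j ≤ (e.symm v).val ∧ (e.symm v).val < 3 * j + 3) ↔
      v = xV n a ∨ v = yV n b ∨ v = zV n b := by
  intro j hj
  obtain ⟨i, hS⟩ := hcomp.exists_spec (by omega)
  have hR : B.Rest e i Finset.univ Finset.univ := by
    refine ⟨fun a => ?_, fun b => ?_, fun b => ?_⟩
    · simpa using (hS.hits_of_z_one he (Or.inl ⟨a, by simp, rfl⟩)).le
    · simpa using (hS.hits_of_z_one he (Or.inr ⟨b, by simp, rfl⟩)).le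
    · simpa using (hS.hits_of_x_one he (Finset.mem_univ b)).le
  have hsize := hR.size_eq i.isLt.le
  have hcard : B.size = n + n + n := by simpa using Fintype.card_congr e
  rw [Finset.card_univ, Fintype.card_fin] at hsize
  have hi : i.val = 0 := by omega
  have h := (BP.triplets_of_spec he n i Finset.univ Finset.univ (by simp) i.isLt.le hR
    fun _ => ⟨i, rfl, hS⟩).2 (by simp) j hj
  simpa only [hi, zero_add] using h

lemma BP.exists_perms_of_triplets (hoa : B.IsOA) (hcomp : B.ComputesPartial (gammaP n)) :
    ∃ π τ : Equiv.Perm (Fin n), ∀ (i : Fin n) (k₀ k₁ k₂ : Fin B.size), k₀.val = 3 * i.val →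
      k₁.val = 3 * i.val + 1 → k₂.val = 3 * i.val + 2 →
      ({B.label k₀, B.label k₁, B.label k₂} : Set (Fin (n + n + n))) =
        {xV n (π (τ i)), yV n (τ i), zV n (τ i)} := by
  set e := Equiv.ofBijective B.label ⟨hoa, hcomp.label_surjective⟩
  have he : ∀ k, e k = B.label k := fun _ => rfl
  choose a b hab using fun j : Fin n => hcomp.exists_triplets he j j.isLt
  have ha : Function.Injective a := fun j j' h => by
    have h1 := (hab j (xV n (a j))).2 (by simp)
    have h2 := (hab j' (xV n (a j))).2 (by simp [h])
    omega
  have hb : Function.Injective b := fun j j' h => by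
    have h1 := (hab j (yV n (b j))).2 (by simp)
    have h2 := (hab j' (yV n (b j))).2 (by simp [h])
    omega
  set α := Equiv.ofBijective a (Finite.injective_iff_bijective.1 ha)
  set β := Equiv.ofBijective b (Finite.injective_iff_bijective.1 hb)
  refine ⟨β.symm.trans α, β, fun i k₀ k₁ k₂ h₀ h₁ h₂ => ?_⟩
  ext v
  simp only [Set.mem_insert_iff, Set.mem_singleton_iff, Equiv.trans_apply,
    Equiv.symm_apply_apply]
  refine Iff.trans ?_ (hab i v)
  simp only [← he, ← Equiv.symm_apply_eq, Fin.ext_iff, h₀, h₁, h₂]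
  omega

end Triplets

/-- if a once-appearance branching program `B` computes (an extension of)
`γ'_n`, then `B` has exactly `3n` non-sink nodes, and for every topological order `ρ` of
`B` the labels come in consecutive triplets `{x_a, y_b, z_b}`; the induced map `b ↦ a`
comes from permutations `π, τ` of `[n]` (block `i` is `{x_{π(τ i)}, y_{τ i}, z_{τ i}}`,
so `b ↦ a` is the permutation `π`). -/
theorem oaBP_gammaP_triplets (n : ℕ) (B : BP (n + n + n)) (hoa : B.IsOA)
    (hcomp : B.ComputesPartial (gammaP n)) :
    ∃ h : B.size = n + n + n, ∀ ρ : Equiv.Perm (Fin B.size), B.IsTopo ρ →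
      ∃ π τ : Equiv.Perm (Fin n), ∀ i : Fin n,
        ({B.label (ρ.symm (Fin.cast h.symm ⟨3 * i.val, by have := i.isLt; omega⟩)),
            B.label (ρ.symm (Fin.cast h.symm ⟨3 * i.val + 1, by have := i.isLt; omega⟩)),
            B.label (ρ.symm (Fin.cast h.symm ⟨3 * i.val + 2, by have := i.isLt; omega⟩))} :
          Set (Fin (n + n + n))) =
        {xV n (π (τ i)), yV n (τ i), zV n (τ i)} := by
  have hsize : B.size = n + n + n := by
    simpa using Fintype.card_of_bijective (f := B.label) ⟨hoa, hcomp.label_surjective⟩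
  refine ⟨hsize, fun ρ hρ => ?_⟩
  have hoa' : (B.reindex ρ hρ).IsOA := hoa.comp ρ.symm.injective
  have hcomp' : (B.reindex ρ hρ).ComputesPartial (gammaP n) := fun w b h => by
    rw [B.eval_reindex ρ hρ]
    exact hcomp w b h
  obtain ⟨π, τ, h⟩ := BP.exists_perms_of_triplets hoa' hcomp'
  exact ⟨π, τ, fun i => h i _ _ _ rfl rfl rfl⟩
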